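/- arXiv:2411.06779 — 3 statements merged into one kernel-verified Lean document; each statement's English description precedes it below -/
import Mathlib

section
/- Let A ∈ ℂ^{n×n} be an orthogonal projection with A⊥ = Iₙ − A, let h ∈ ℂ^{n×n} satisfy h = AhA, let Q : [0,∞) → ℂ^{n×n} be continuous, and let λ ∈ ℂ. Suppose φ, φ* : [0,∞) → ℂ^{n×n} are twice differentiable with −φ'' + Qφ = λφ, φ(0) = A, φ'(0) = A⊥ + h, and −(φ*)'' + φ*Q = λφ*, φ*(0) = A, (φ*)'(0) = A⊥ + h. Then for all x ≥ 0, φ*(x)φ'(x) − (φ*)'(x)φ(x) = 0ₙ (the n×n zero matrix). -/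
open Set MeasureTheory Matrix

attribute [local instance] Matrix.linftyOpNormedAddCommGroup Matrix.linftyOpNormedSpace

/-- The product rule for matrix-valued functions of a real variable. -/
theorem Matrix.hasDerivWithinAt_mul {n : ℕ} {f g : ℝ → Matrix (Fin n) (Fin n) ℂ}
    {f' g' : Matrix (Fin n) (Fin n) ℂ} {s : Set ℝ} {x : ℝ}
    (hf : HasDerivWithinAt f f' s x) (hg : HasDerivWithinAt g g' s x) :
    HasDerivWithinAt (fun y => f y * g y) (f' * g x + f x * g') s x := by
  let _ := Matrix.linftyOpNormedRing (n := Fin n) (α := ℂ)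
  let _ := Matrix.linftyOpNormedAlgebra (n := Fin n) (R := ℝ) (α := ℂ)
  exact HasDerivWithinAt.mul hf hg

/-- With `A` an orthogonal projection, `A⊥ = 1 - A`, `h = AhA`,
if `-φ'' + Qφ = λφ`, `φ(0) = A`, `φ'(0) = A⊥ + h` and `-(φ*)'' + φ*Q = λφ*`,
`φ*(0) = A`, `(φ*)'(0) = A⊥ + h`, then `φ*(x)φ'(x) - (φ*)'(x)φ(x) = 0` for all `x ≥ 0`. -/
theorem stmt_3 (n : ℕ) (A h : Matrix (Fin n) (Fin n) ℂ)
    (hA1 : Aᴴ = A) (hA2 : A * A = A) (hh : h = A * h * A)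
    (Q φ φ' φ'' ψ ψ' ψ'' : ℝ → Matrix (Fin n) (Fin n) ℂ)
    (hQ : ContinuousOn Q (Ici 0)) (lam : ℂ)
    (hφ : ∀ x ∈ Ici (0:ℝ), HasDerivWithinAt φ (φ' x) (Ici 0) x)
    (hφ' : ∀ x ∈ Ici (0:ℝ), HasDerivWithinAt φ' (φ'' x) (Ici 0) x)
    (hψ : ∀ x ∈ Ici (0:ℝ), HasDerivWithinAt ψ (ψ' x) (Ici 0) x)
    (hψ' : ∀ x ∈ Ici (0:ℝ), HasDerivWithinAt ψ' (ψ'' x) (Ici 0) x)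
    (heqφ : ∀ x ∈ Ici (0:ℝ), -φ'' x + Q x * φ x = lam • φ x)
    (heqψ : ∀ x ∈ Ici (0:ℝ), -ψ'' x + ψ x * Q x = lam • ψ x)
    (hφ0 : φ 0 = A) (hφ'0 : φ' 0 = (1 - A) + h)
    (hψ0 : ψ 0 = A) (hψ'0 : ψ' 0 = (1 - A) + h) :
    ∀ x ∈ Ici (0:ℝ), ψ x * φ' x - ψ' x * φ x = 0 := by
  have hderiv : ∀ x ∈ Ici (0:ℝ),
      HasDerivWithinAt (fun y => ψ y * φ' y - ψ' y * φ y) 0 (Ici 0) x := by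
    intro x hx
    have hW := (Matrix.hasDerivWithinAt_mul (hψ x hx) (hφ' x hx)).sub
      (Matrix.hasDerivWithinAt_mul (hψ' x hx) (hφ x hx))
    have hφ'' : φ'' x = Q x * φ x - lam • φ x := by rw [← heqφ x hx]; abel
    have hψ'' : ψ'' x = ψ x * Q x - lam • ψ x := by rw [← heqψ x hx]; abel
    have hzero : ψ' x * φ' x + ψ x * φ'' x - (ψ'' x * φ x + ψ' x * φ' x) = 0 := by
      rw [hφ'', hψ'', mul_sub, sub_mul, Matrix.mul_smul, Matrix.smul_mul, mul_assoc]
      abel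
    exact hzero ▸ hW
  have hAh : A * h = h := by rw [hh, ← mul_assoc, ← mul_assoc, hA2]
  have hhA : h * A = h := by rw [hh, mul_assoc, hA2]
  have h0 : ψ 0 * φ' 0 - ψ' 0 * φ 0 = 0 := by
    rw [hφ0, hφ'0, hψ0, hψ'0, mul_add, add_mul, mul_sub, sub_mul, hA2, hAh, hhA]
    simp
  intro x hx
  have hconst := constant_of_has_deriv_right_zero (a := 0) (b := x)
    (f := fun y => ψ y * φ' y - ψ' y * φ y)
    (fun y hy => ((hderiv y hy.1).continuousWithinAt).mono Icc_subset_Ici_self)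
    (fun y hy => (hderiv y hy.1).mono (Ici_subset_Ici.2 hy.1))
    x (right_mem_Icc.2 hx)
  exact hconst.trans h0
end

section
/- Let A ∈ ℂ^{n×n} be an orthogonal projection with A⊥ = Iₙ − A, let h ∈ ℂ^{n×n} satisfy h = AhA, let Q : [0,∞) → ℂ^{n×n} be continuous, and let λ ∈ ℂ. Let φ, S : [0,∞) → ℂ^{n×n} be twice differentiable solutions of −Y'' + QY = λY with φ(0) = A, φ'(0) = A⊥ + h and S(0) = −A⊥, S'(0) = A, and let φ*, S* : [0,∞) → ℂ^{n×n} be twice differentiable solutions of −Z'' + ZQ = λZ with φ*(0) = A, (φ*)'(0) = A⊥ + h and S*(0) = −A⊥, (S*)'(0) = A. Then for every x ≥ 0 the 2n×2n block matrix [[φ(x), S(x)], [φ'(x), S'(x)]] is invertible, and its inverse equals the block matrix [[(S*)'(x), −S*(x)], [−(φ*)'(x), φ*(x)]]. -/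
open Set MeasureTheory Matrix

attribute [local instance] Matrix.linftyOpNormedAddCommGroup Matrix.linftyOpNormedSpace

attribute [local instance] Matrix.linftyOpNormedRing Matrix.linftyOpNormedAlgebra in
/-- The Wronskian of a solution `Z` of `-Z'' + ZQ = λZ` and a solution `Y` of
`-Y'' + QY = λY` is constant on `[0, ∞)`. -/
lemma wronskian_eq_wronskian_zero {n : Type*} [Fintype n] [DecidableEq n]
    {Q Y Y' Y'' Z Z' Z'' : ℝ → Matrix n n ℂ} {lam : ℂ}
    (hY : ∀ x ∈ Ici (0:ℝ), HasDerivWithinAt Y (Y' x) (Ici 0) x)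
    (hY' : ∀ x ∈ Ici (0:ℝ), HasDerivWithinAt Y' (Y'' x) (Ici 0) x)
    (hZ : ∀ x ∈ Ici (0:ℝ), HasDerivWithinAt Z (Z' x) (Ici 0) x)
    (hZ' : ∀ x ∈ Ici (0:ℝ), HasDerivWithinAt Z' (Z'' x) (Ici 0) x)
    (heqY : ∀ x ∈ Ici (0:ℝ), -Y'' x + Q x * Y x = lam • Y x)
    (heqZ : ∀ x ∈ Ici (0:ℝ), -Z'' x + Z x * Q x = lam • Z x)
    {x : ℝ} (hx : x ∈ Ici (0:ℝ)) :
    Z' x * Y x - Z x * Y' x = Z' 0 * Y 0 - Z 0 * Y' 0 := by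
  have hW : ∀ t ∈ Ici (0:ℝ),
      HasDerivWithinAt (fun t => Z' t * Y t - Z t * Y' t) 0 (Ici 0) t := by
    intro t ht
    have hZ'' : Z'' t = Z t * Q t - lam • Z t := by rw [← heqZ t ht]; abel
    have hY'' : Y'' t = Q t * Y t - lam • Y t := by rw [← heqY t ht]; abel
    refine (((hZ' t ht).mul (hY t ht)).sub ((hZ t ht).mul (hY' t ht))).congr_deriv ?_
    rw [hZ'', hY'']
    simp only [sub_mul, mul_sub, smul_mul_assoc, mul_smul_comm, mul_assoc]
    abel
  refine (convex_Ici (0:ℝ)).is_const_of_fderivWithin_eq_zero (𝕜 := ℝ)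
    (f := fun t => Z' t * Y t - Z t * Y' t)
    (fun t ht => (hW t ht).differentiableWithinAt) (fun t ht => ?_) hx self_mem_Ici
  exact ((hW t ht).hasFDerivWithinAt.fderivWithin (uniqueDiffOn_Ici 0 t ht)).trans
    (ContinuousLinearMap.ext fun r => smul_zero r)

/-- With `A` an orthogonal projection, `A⊥ = 1 - A`, `h = AhA`,
let `φ, S` solve `-Y'' + QY = λY` with `φ(0) = A`, `φ'(0) = A⊥ + h`, `S(0) = -A⊥`,
`S'(0) = A`, and let `φ*, S*` solve `-Z'' + ZQ = λZ` with `φ*(0) = A`,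
`(φ*)'(0) = A⊥ + h`, `S*(0) = -A⊥`, `(S*)'(0) = A`. Then for every `x ≥ 0` the block
matrix `[[φ(x), S(x)], [φ'(x), S'(x)]]` is invertible with inverse
`[[(S*)'(x), -S*(x)], [-(φ*)'(x), φ*(x)]]`. -/
theorem stmt_5 (n : ℕ) (A h : Matrix (Fin n) (Fin n) ℂ)
    (hA1 : Aᴴ = A) (hA2 : A * A = A) (hh : h = A * h * A)
    (Q φ φ' φ'' S S' S'' φs φs' φs'' Ss Ss' Ss'' : ℝ → Matrix (Fin n) (Fin n) ℂ)
    (hQ : ContinuousOn Q (Ici 0)) (lam : ℂ)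
    (hφ : ∀ x ∈ Ici (0:ℝ), HasDerivWithinAt φ (φ' x) (Ici 0) x)
    (hφ' : ∀ x ∈ Ici (0:ℝ), HasDerivWithinAt φ' (φ'' x) (Ici 0) x)
    (hS : ∀ x ∈ Ici (0:ℝ), HasDerivWithinAt S (S' x) (Ici 0) x)
    (hS' : ∀ x ∈ Ici (0:ℝ), HasDerivWithinAt S' (S'' x) (Ici 0) x)
    (hφs : ∀ x ∈ Ici (0:ℝ), HasDerivWithinAt φs (φs' x) (Ici 0) x)
    (hφs' : ∀ x ∈ Ici (0:ℝ), HasDerivWithinAt φs' (φs'' x) (Ici 0) x)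
    (hSs : ∀ x ∈ Ici (0:ℝ), HasDerivWithinAt Ss (Ss' x) (Ici 0) x)
    (hSs' : ∀ x ∈ Ici (0:ℝ), HasDerivWithinAt Ss' (Ss'' x) (Ici 0) x)
    (heqφ : ∀ x ∈ Ici (0:ℝ), -φ'' x + Q x * φ x = lam • φ x)
    (heqS : ∀ x ∈ Ici (0:ℝ), -S'' x + Q x * S x = lam • S x)
    (heqφs : ∀ x ∈ Ici (0:ℝ), -φs'' x + φs x * Q x = lam • φs x)
    (heqSs : ∀ x ∈ Ici (0:ℝ), -Ss'' x + Ss x * Q x = lam • Ss x)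
    (hφ0 : φ 0 = A) (hφ'0 : φ' 0 = (1 - A) + h)
    (hS0 : S 0 = -(1 - A)) (hS'0 : S' 0 = A)
    (hφs0 : φs 0 = A) (hφs'0 : φs' 0 = (1 - A) + h)
    (hSs0 : Ss 0 = -(1 - A)) (hSs'0 : Ss' 0 = A) :
    ∀ x ∈ Ici (0:ℝ),
      IsUnit (Matrix.fromBlocks (φ x) (S x) (φ' x) (S' x)) ∧
      (Matrix.fromBlocks (φ x) (S x) (φ' x) (S' x))⁻¹ =
        Matrix.fromBlocks (Ss' x) (-(Ss x)) (-(φs' x)) (φs x) := by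
  intro x hx
  have h₁ : A * h = h := by rw [hh, ← mul_assoc, ← mul_assoc, hA2]
  have h₂ : h * A = h := by rw [hh, mul_assoc, hA2]
  have w₁ := wronskian_eq_wronskian_zero hφ hφ' hSs hSs' heqφ heqSs hx
  have w₂ := wronskian_eq_wronskian_zero hS hS' hSs hSs' heqS heqSs hx
  have w₃ := wronskian_eq_wronskian_zero hφ hφ' hφs hφs' heqφ heqφs hx
  have w₄ := wronskian_eq_wronskian_zero hS hS' hφs hφs' heqS heqφs hx
  simp only [hφ0, hφ'0, hS0, hS'0, hφs0, hφs'0, hSs0, hSs'0] at w₁ w₂ w₃ w₄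
  have hmul : Matrix.fromBlocks (Ss' x) (-(Ss x)) (-(φs' x)) (φs x) *
      Matrix.fromBlocks (φ x) (S x) (φ' x) (S' x) = 1 := by
    rw [Matrix.fromBlocks_multiply, ← Matrix.fromBlocks_one]
    congr 1
    · rw [neg_mul, ← sub_eq_add_neg, w₁]
      noncomm_ring [hA2, h₁, h₂]
    · rw [neg_mul, ← sub_eq_add_neg, w₂]
      noncomm_ring [hA2, h₁, h₂]
    · rw [neg_mul, neg_add_eq_sub, ← neg_sub, w₃]
      noncomm_ring [hA2, h₁, h₂]
    · rw [neg_mul, neg_add_eq_sub, ← neg_sub, w₄]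
      noncomm_ring [hA2, h₁, h₂]
  exact ⟨.of_mul_eq_one_right _ hmul, Matrix.inv_eq_left_inv hmul⟩
end

section
/- Let U ∈ ℂ^{n×n} be a unitary matrix, and set A₁ := (U + Iₙ)/2 and B₁ := (i/2)(U − Iₙ). Then there exist an invertible matrix A₀ ∈ ℂ^{n×n}, an orthogonal projection A ∈ ℂ^{n×n} (i.e. A† = A = A²), and a matrix h ∈ ℂ^{n×n} with h† = h and h = AhA, such that A₁A₀ = A and B₁A₀ = −(Iₙ − A) + h. -/
open Matrix

/-- If a unitary element `u` of a C⋆-algebra has finite spectrum, then `(u + 1) / 2` and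
`(i / 2) (u - 1)` can be normalized by an invertible factor `a₀` to `p` and `-(1 - p) + h`, with `p`
a projection and `h` a self-adjoint element of the corner cut out by `p`. -/
theorem exists_isUnit_mul_eq_projection {A : Type*} [CStarAlgebra A] {u : A}
    (hu : u ∈ unitary A) (hfin : (spectrum ℂ u).Finite) :
    ∃ a₀ p h : A, IsUnit a₀ ∧ star p = p ∧ p * p = p ∧ star h = h ∧ h = p * h * p ∧
      ((2 : ℂ)⁻¹ • (u + 1)) * a₀ = p ∧
      ((Complex.I / 2) • (u - 1)) * a₀ = -(1 - p) + h := by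
  have hn : IsStarNormal u := ⟨(hu.1.trans hu.2.symm : star u * u = u * star u)⟩
  have hc (f : ℂ → ℂ) : ContinuousOn f (spectrum ℂ u) := hfin.continuousOn f
  have hmul (f g : ℂ → ℂ) : cfc f u * cfc g u = cfc (fun z ↦ f z * g z) u :=
    (cfc_mul f g u (hc f) (hc g)).symm
  have hadd : (2 : ℂ)⁻¹ • (u + 1) = cfc (fun z : ℂ ↦ (2 : ℂ)⁻¹ * (z + 1)) u := by
    rw [cfc_const_mul _ _ u (hc _), cfc_add_const _ _ u (hc _), cfc_id' ℂ u, map_one]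
  have hsub : (Complex.I / 2) • (u - 1) = cfc (fun z : ℂ ↦ Complex.I / 2 * (z - 1)) u := by
    rw [cfc_const_mul _ _ u (hc _), cfc_sub _ _ u (hc _) (hc _), cfc_id' ℂ u, cfc_const_one ℂ u]
  have hne {z : ℂ} (hz : z ≠ -1) : z + 1 ≠ 0 := fun h ↦ hz (eq_neg_of_add_eq_zero_left h)
  let a₀ : ℂ → ℂ := fun z ↦ if z = -1 then -Complex.I else 2 / (z + 1)
  let b₀ : ℂ → ℂ := fun z ↦ if z = -1 then Complex.I else (z + 1) / 2
  let p : ℂ → ℂ := fun z ↦ if z = -1 then 0 else 1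
  let h : ℂ → ℂ := fun z ↦ if z = -1 then 0 else Complex.I * (z - 1) / (z + 1)
  have hab (z : ℂ) : a₀ z * b₀ z = 1 := by
    by_cases hz : z = -1
    · simp [a₀, b₀, hz]
    · have := hne hz
      simp only [a₀, b₀, hz, if_false]
      field_simp
  refine ⟨cfc a₀ u, cfc p u, cfc h u, ?_, ?_, ?_, ?_, ?_, ?_, ?_⟩
  · refine isUnit_iff_exists.2 ⟨cfc b₀ u, ?_, ?_⟩
    · simp only [hmul, hab, cfc_const_one ℂ u]
    · simp only [hmul, mul_comm (b₀ _), hab, cfc_const_one ℂ u]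
  · rw [← cfc_star]
    congr 1
    ext1 z
    by_cases hz : z = -1 <;> simp [p, hz]
  · rw [hmul]
    congr 1
    ext1 z
    by_cases hz : z = -1 <;> simp [p, hz]
  · rw [← cfc_star]
    refine cfc_congr fun z hz ↦ ?_
    have hz1 : ‖z‖ = 1 := by simpa using spectrum.subset_circle_of_unitary hu hz
    have hz0 : z ≠ 0 := by rintro rfl; simp at hz1
    have hconj : star z = z⁻¹ := (Complex.inv_eq_conj hz1).symm
    by_cases hz' : z = -1
    · simp [h, hz']
    · have h1 := hne hz'
      have h2 : 1 + z ≠ 0 := by rwa [add_comm]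
      have hI : star Complex.I = -Complex.I := Complex.conj_I
      simp only [h, hz', if_false, star_div₀, star_mul', star_sub, star_add, star_one, hconj, hI]
      have h3 : z⁻¹ + 1 ≠ 0 := by
        intro h0
        field_simp at h0
        exact h2 (h0.trans (mul_zero z))
      rw [div_eq_div_iff h3 h1]
      field_simp
      ring
  · rw [hmul, hmul]
    congr 1
    ext1 z
    by_cases hz : z = -1 <;> simp [p, h, hz]
  · rw [hadd, hmul]
    congr 1
    ext1 z
    by_cases hz : z = -1
    · simp [p, hz]
    · have := hne hz
      simp only [a₀, p, hz, if_false]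
      field_simp
  · rw [hsub, hmul, ← cfc_const_one ℂ u, ← cfc_sub _ _ u (hc _) (hc _), ← cfc_neg,
      ← cfc_add _ _ _ (hc _) (hc _)]
    congr 1
    ext1 z
    by_cases hz : z = -1
    · simp only [a₀, p, h, hz, if_true]
      linear_combination Complex.I_mul_I
    · have := hne hz
      simp only [a₀, p, h, hz, if_false]
      field_simp
      ring

/-- for a unitary `U`, with `A₁ = (U + Iₙ)/2` and `B₁ = (i/2)(U - Iₙ)`,
there exist an invertible `A₀`, an orthogonal projection `A`, and a Hermitian `h`
with `h = AhA`, such that `A₁A₀ = A` and `B₁A₀ = -(Iₙ - A) + h`. -/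
theorem stmt_17 (n : ℕ) (U : Matrix (Fin n) (Fin n) ℂ) (hU : Uᴴ * U = 1) :
    ∃ A₀ A h : Matrix (Fin n) (Fin n) ℂ,
      IsUnit A₀ ∧ Aᴴ = A ∧ A * A = A ∧ hᴴ = h ∧ h = A * h * A ∧
      ((2:ℂ)⁻¹ • (U + 1)) * A₀ = A ∧
      ((Complex.I / 2) • (U - 1)) * A₀ = -(1 - A) + h := by
  open scoped Matrix.Norms.L2Operator in
  exact exists_isUnit_mul_eq_projection (mem_unitaryGroup_iff'.2 hU) (Matrix.finite_spectrum U)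
end
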